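/- Assume m ≥ 2 and let M be a nonempty set of pairs (i,j) with 1 ≤ i < j ≤ m; for each (i,j) ∈ M fix β̃_{ij} ∈ Δ_m supported on coordinates {i,j}, and fix R ∈ ℝ with R ≤ inf over λ ∈ Δ_M of L(Σ_{(i,j)∈M} λ_{ij}·β̃_{ij}). Define Ŝ = {x ∈ ℝ^m : for all β ∈ Δ_m, ⟨β, x⟩ ≥ I'_concave(β)} and, for w ∈ Δ_K and Q : {1,…,K} → Δ_X, the vector payoff f(w,Q) ∈ ℝ^m with components f_i(w,Q) = Σ_{a=1}^K w(a)·D(Q_a‖ν^i_a). Then Ŝ is a closed convex nonempty set which is a B-set for the agent: for every y ∉ Ŝ, letting y* be the (unique) Euclidean nearest point of y in Ŝ, there exists w ∈ Δ_K such that for all Q : {1,…,K} → Δ_X, ⟨y − y*, f(w,Q) − y*⟩ ≤ 0. -/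

import Mathlib

/-- A probability mass function on a finite type. -/
def IsPMF {X : Type*} [Fintype X] (q : X → ℝ) : Prop :=
  (∀ x, 0 ≤ q x) ∧ ∑ x, q x = 1

/-- KL divergence between pmfs on a finite type (convention `0 · log 0 = 0`). -/
noncomputable def KL {X : Type*} [Fintype X] (q p : X → ℝ) : ℝ :=
  ∑ x, q x * Real.log (q x / p x)

/-- `J_a(β) = −log Σ_x Π_i ν^i_a(x)^{β_i}`. -/
noncomputable def Jfun {X : Type*} [Fintype X] {K m : ℕ} (ν : Fin m → Fin K → X → ℝ)
    (a : Fin K) (β : Fin m → ℝ) : ℝ :=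
  -Real.log (∑ x, ∏ i, ν i a x ^ β i)

/-- `I(β) = min_a J_a(β)`. -/
noncomputable def Ifun {X : Type*} [Fintype X] {K m : ℕ} (ν : Fin m → Fin K → X → ℝ)
    (β : Fin m → ℝ) : ℝ :=
  ⨅ a : Fin K, Jfun ν a β

/-- `L(β) = max_a J_a(β)`. -/
noncomputable def Lfun {X : Type*} [Fintype X] {K m : ℕ} (ν : Fin m → Fin K → X → ℝ)
    (β : Fin m → ℝ) : ℝ :=
  ⨆ a : Fin K, Jfun ν a β

/-- The perturbed upper concave envelope `I'_concave(β)` determined by `R`, the set of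
perturbed pairs `M` and the perturbation points `β̃`. -/
noncomputable def Iconc {X : Type*} [Fintype X] {K m : ℕ} (ν : Fin m → Fin K → X → ℝ)
    (R : ℝ) (M : Finset (Fin m × Fin m)) (βt : Fin m × Fin m → Fin m → ℝ)
    (β : Fin m → ℝ) : ℝ :=
  sSup {r : ℝ | ∃ (lam : {p // p ∈ M} → ℝ) (lb : ℝ) (β' : Fin m → ℝ),
    (∀ p, 0 ≤ lam p) ∧ 0 ≤ lb ∧ (∑ p, lam p) + lb = 1 ∧
    β' ∈ stdSimplex ℝ (Fin m) ∧
    β = (fun k => (∑ p : {p // p ∈ M}, lam p * βt p.1 k) + lb * β' k) ∧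
    r = R * (∑ p, lam p) + lb * Ifun ν β'}

section Gibbs

theorem prod_rpow_pos {X : Type*} {K m : ℕ} {ν : Fin m → Fin K → X → ℝ}
    (hfull : ∀ i a x, 0 < ν i a x) (a : Fin K) (β : Fin m → ℝ) (x : X) :
    0 < ∏ i, ν i a x ^ β i :=
  Finset.prod_pos fun i _ => Real.rpow_pos_of_pos (hfull i a x) _

variable {X : Type*} [Fintype X]

theorem KL_nonneg {q p : X → ℝ} (hq : IsPMF q) (hp : ∀ x, 0 < p x) (hp1 : ∑ x, p x = 1) :
    0 ≤ KL q p := by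
  have key : ∀ x, q x - p x ≤ q x * Real.log (q x / p x) := by
    intro x
    rcases (hq.1 x).eq_or_lt with h | h
    · simpa [← h] using (hp x).le
    · have h1 := Real.one_sub_inv_le_log_of_pos (div_pos h (hp x))
      have h2 := mul_le_mul_of_nonneg_left h1 h.le
      have h3 : q x * (1 - (q x / p x)⁻¹) = q x - p x := by
        field_simp
      linarith
  have h := Finset.sum_le_sum fun x (_ : x ∈ Finset.univ) => key x
  rw [Finset.sum_sub_distrib, hq.2, hp1] at h
  simpa [KL] using h

variable {K m : ℕ} {ν : Fin m → Fin K → X → ℝ}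

theorem sum_prod_rpow_pos [Nonempty X] (hfull : ∀ i a x, 0 < ν i a x) (a : Fin K)
    (β : Fin m → ℝ) : 0 < ∑ x, ∏ i, ν i a x ^ β i :=
  Finset.sum_pos (fun x _ => prod_rpow_pos hfull a β x) Finset.univ_nonempty

/-- The normalized geometric mixture of the laws `ν i a` with weights `β`. -/
noncomputable def geomMix (ν : Fin m → Fin K → X → ℝ) (a : Fin K) (β : Fin m → ℝ) (x : X) : ℝ :=
  (∏ i, ν i a x ^ β i) / ∑ z, ∏ i, ν i a z ^ β i

theorem geomMix_pos [Nonempty X] (hfull : ∀ i a x, 0 < ν i a x) (a : Fin K) (β : Fin m → ℝ)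
    (x : X) : 0 < geomMix ν a β x :=
  div_pos (prod_rpow_pos hfull a β x) (sum_prod_rpow_pos hfull a β)

theorem sum_geomMix [Nonempty X] (hfull : ∀ i a x, 0 < ν i a x) (a : Fin K) (β : Fin m → ℝ) :
    ∑ x, geomMix ν a β x = 1 := by
  simp only [geomMix]
  rw [← Finset.sum_div, div_self (sum_prod_rpow_pos hfull a β).ne']

theorem isPMF_geomMix [Nonempty X] (hfull : ∀ i a x, 0 < ν i a x) (a : Fin K) (β : Fin m → ℝ) :
    IsPMF (geomMix ν a β) :=
  ⟨fun x => (geomMix_pos hfull a β x).le, sum_geomMix hfull a β⟩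

/-- Gibbs' identity. -/
theorem sum_mul_KL_eq [Nonempty X] (hfull : ∀ i a x, 0 < ν i a x) (a : Fin K) {β : Fin m → ℝ}
    (hβ : ∑ i, β i = 1) {q : X → ℝ} (hq : IsPMF q) :
    ∑ i, β i * KL q (ν i a) = KL q (geomMix ν a β) + Jfun ν a β := by
  have key : ∀ x, ∑ i, β i * (q x * Real.log (q x / ν i a x)) =
      q x * Real.log (q x / geomMix ν a β x)
        - q x * Real.log (∑ z, ∏ i, ν i a z ^ β i) := by
    intro x
    rcases (hq.1 x).eq_or_lt with h | h
    · simp [← h]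
    · have e1 : Real.log (q x / geomMix ν a β x) = Real.log (q x)
          - (∑ i, β i * Real.log (ν i a x) - Real.log (∑ z, ∏ i, ν i a z ^ β i)) := by
        rw [Real.log_div h.ne' (geomMix_pos hfull a β x).ne', geomMix,
          Real.log_div (prod_rpow_pos hfull a β x).ne' (sum_prod_rpow_pos hfull a β).ne',
          Real.log_prod (fun i _ => (Real.rpow_pos_of_pos (hfull i a x) _).ne')]
        simp only [Real.log_rpow (hfull _ a x)]
      have e2 : ∀ i, β i * (q x * Real.log (q x / ν i a x)) =
          β i * (q x * Real.log (q x)) - q x * (β i * Real.log (ν i a x)) := by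
        intro i
        rw [Real.log_div h.ne' (hfull i a x).ne']
        ring
      simp only [e2]
      rw [Finset.sum_sub_distrib, ← Finset.sum_mul, ← Finset.mul_sum, hβ, e1]
      ring
  simp only [KL, Finset.mul_sum]
  rw [Finset.sum_comm]
  simp only [key]
  rw [Finset.sum_sub_distrib, ← Finset.sum_mul, hq.2, Jfun]
  ring

theorem Jfun_le_sum_mul_KL [Nonempty X] (hfull : ∀ i a x, 0 < ν i a x) (a : Fin K)
    {β : Fin m → ℝ} (hβ : ∑ i, β i = 1) {q : X → ℝ} (hq : IsPMF q) :
    Jfun ν a β ≤ ∑ i, β i * KL q (ν i a) := by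
  rw [sum_mul_KL_eq hfull a hβ hq]
  linarith [KL_nonneg hq (geomMix_pos hfull a β) (sum_geomMix hfull a β)]

theorem sum_mul_KL_geomMix [Nonempty X] (hfull : ∀ i a x, 0 < ν i a x) (a : Fin K)
    {β : Fin m → ℝ} (hβ : ∑ i, β i = 1) :
    ∑ i, β i * KL (geomMix ν a β) (ν i a) = Jfun ν a β := by
  rw [sum_mul_KL_eq hfull a hβ (isPMF_geomMix hfull a β)]
  simp [KL, div_self (geomMix_pos hfull a β _).ne']

theorem Jfun_nonneg [Nonempty X] (hν : ∀ i a, IsPMF (ν i a)) (hfull : ∀ i a x, 0 < ν i a x)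
    (a : Fin K) {β : Fin m → ℝ} (hβ : β ∈ stdSimplex ℝ (Fin m)) : 0 ≤ Jfun ν a β := by
  rw [← sum_mul_KL_geomMix hfull a hβ.2]
  exact Finset.sum_nonneg fun i _ => mul_nonneg (hβ.1 i)
    (KL_nonneg (isPMF_geomMix hfull a β) (hfull i a) (hν i a).2)

theorem concaveOn_Jfun [Nonempty X] (hfull : ∀ i a x, 0 < ν i a x) (a : Fin K) :
    ConcaveOn ℝ (stdSimplex ℝ (Fin m)) (Jfun ν a) := by
  refine ⟨convex_stdSimplex ℝ _, fun β₁ h₁ β₂ h₂ s t hs ht hst => ?_⟩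
  have hβ := convex_stdSimplex ℝ (Fin m) h₁ h₂ hs ht hst
  have hq := isPMF_geomMix hfull a (s • β₁ + t • β₂)
  rw [← sum_mul_KL_geomMix hfull a hβ.2]
  have e : ∑ i, (s • β₁ + t • β₂) i * KL (geomMix ν a (s • β₁ + t • β₂)) (ν i a) =
      s • ∑ i, β₁ i * KL (geomMix ν a (s • β₁ + t • β₂)) (ν i a) +
      t • ∑ i, β₂ i * KL (geomMix ν a (s • β₁ + t • β₂)) (ν i a) := by
    simp only [smul_eq_mul, Finset.mul_sum, ← Finset.sum_add_distrib, Pi.add_apply, Pi.smul_apply]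
    exact Finset.sum_congr rfl fun i _ => by ring
  rw [e]
  gcongr
  · exact Jfun_le_sum_mul_KL hfull a h₁.2 hq
  · exact Jfun_le_sum_mul_KL hfull a h₂.2 hq

theorem continuous_Jfun [Nonempty X] (hfull : ∀ i a x, 0 < ν i a x) (a : Fin K) :
    Continuous (Jfun ν a) := by
  refine (Continuous.log ?_ fun β => (sum_prod_rpow_pos hfull a β).ne').neg
  exact continuous_finsetSum _ fun x _ => continuous_finsetProd _ fun i _ =>
    continuous_const.rpow (continuous_apply i) fun _ => Or.inl (hfull i a x).ne'

theorem Ifun_le_Jfun (a : Fin K) (β : Fin m → ℝ) : Ifun ν β ≤ Jfun ν a β :=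
  ciInf_le (Set.finite_range _).bddBelow a

theorem continuous_Ifun [Nonempty X] [Nonempty (Fin K)] (hfull : ∀ i a x, 0 < ν i a x) :
    Continuous (Ifun ν) := by
  have h : Ifun ν = fun β => Finset.univ.inf' Finset.univ_nonempty fun a => Jfun ν a β :=
    funext fun β => (Finset.inf'_univ_eq_ciInf _).symm
  rw [h]
  exact Continuous.finset_inf'_apply _ fun a _ => continuous_Jfun hfull a

theorem Ifun_nonneg [Nonempty X] (hν : ∀ i a, IsPMF (ν i a)) (hfull : ∀ i a x, 0 < ν i a x)
    {β : Fin m → ℝ} (hβ : β ∈ stdSimplex ℝ (Fin m)) : 0 ≤ Ifun ν β :=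
  Real.iInf_nonneg fun a => Jfun_nonneg hν hfull a hβ

theorem concaveOn_Ifun [Nonempty X] [Nonempty (Fin K)] (hfull : ∀ i a x, 0 < ν i a x) :
    ConcaveOn ℝ (stdSimplex ℝ (Fin m)) (Ifun ν) := by
  refine ⟨convex_stdSimplex ℝ _, fun β₁ h₁ β₂ h₂ s t hs ht hst => le_ciInf fun a => ?_⟩
  refine le_trans ?_ ((concaveOn_Jfun hfull a).2 h₁ h₂ hs ht hst)
  gcongr <;> exact Ifun_le_Jfun a _

end Gibbs

section Convexity

theorem isCompact_convexJoin {E : Type*} [AddCommGroup E] [Module ℝ E] [TopologicalSpace E]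
    [IsTopologicalAddGroup E] [ContinuousSMul ℝ E] {s t : Set E}
    (hs : IsCompact s) (ht : IsCompact t) : IsCompact (convexJoin ℝ s t) := by
  have h : convexJoin ℝ s t =
      (fun z : ℝ × E × E => (1 - z.1) • z.2.1 + z.1 • z.2.2) '' (Set.Icc (0 : ℝ) 1 ×ˢ s ×ˢ t) := by
    ext z
    simp only [mem_convexJoin, segment_eq_image, Set.mem_image, Prod.exists, Set.mem_prod]
    constructor
    · rintro ⟨x, hx, y, hy, θ, hθ, rfl⟩
      exact ⟨θ, x, y, ⟨hθ, hx, hy⟩, rfl⟩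
    · rintro ⟨θ, x, y, ⟨hθ, hx, hy⟩, rfl⟩
      exact ⟨x, hx, y, hy, θ, hθ, rfl⟩
  rw [h]
  exact (isCompact_Icc.prod (hs.prod ht)).image (by fun_prop)

/-- If `t ≤ ⟨β, x⟩` for every `x` whose pairing dominates the compact convex set `C`, then `C`
contains a point above `(β, t)`. -/
theorem exists_mem_ge_of_forall_dominating {ι : Type*} [Fintype ι] {C : Set ((ι → ℝ) × ℝ)}
    (hC : IsCompact C) (hconv : Convex ℝ C) (hsum : ∀ z ∈ C, ∑ k, z.1 k = 1)
    {β : ι → ℝ} (hβ : ∃ r, (β, r) ∈ C) {t : ℝ}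
    (h : ∀ x : ι → ℝ, (∀ z ∈ C, z.2 ≤ ∑ k, z.1 k * x k) → t ≤ ∑ k, β k * x k) :
    ∃ r, t ≤ r ∧ (β, r) ∈ C := by
  classical
  by_contra! hcon
  obtain ⟨r₀, hr₀⟩ := hβ
  have hdisj : Disjoint C ({β} ×ˢ Set.Ici t) := by
    rw [Set.disjoint_left]
    rintro ⟨b, r⟩ hz ⟨hb, hr⟩
    obtain rfl : b = β := hb
    exact hcon r hr hz
  obtain ⟨f, u, v, hfC, huv, hfv⟩ := geometric_hahn_banach_compact_closed hconv hC
    ((convex_singleton β).prod (convex_Ici t)) (isClosed_singleton.prod isClosed_Ici) hdisj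
  set s := f (0, 1)
  set g : ι → ℝ := fun k => f (Pi.single k 1, 0)
  have hf : ∀ b r, f (b, r) = ∑ k, b k * g k + r * s := by
    intro b r
    have e : ((b, r) : (ι → ℝ) × ℝ) =
        ∑ k, b k • ((Pi.single k 1 : ι → ℝ), (0 : ℝ)) + r • ((0 : ι → ℝ), (1 : ℝ)) := by
      ext k
      · simp [Prod.fst_sum, Finset.sum_apply, Pi.single_apply]
      · simp [Prod.snd_sum]
    rw [e, map_add, map_sum, map_smul]
    simp only [map_smul, smul_eq_mul, g, s]
  have hβ0 := hfC _ hr₀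
  have hβt : ∀ r, t ≤ r → v < f (β, r) := fun r hr => hfv _ ⟨rfl, hr⟩
  have hs : 0 < s := by
    have h1 := hβt (max t r₀ + 1) (by linarith [le_max_left t r₀])
    rw [hf] at h1 hβ0
    nlinarith [le_max_right t r₀]
  have hsum1 : ∑ k, β k = 1 := hsum _ hr₀
  have hpair : ∀ b : ι → ℝ, ∑ k, b k = 1 →
      ∑ k, b k * ((u - g k) / s) = (u - ∑ k, b k * g k) / s := by
    intro b hb
    have : ∀ k, b k * ((u - g k) / s) = (b k * u - b k * g k) / s := fun k => by ring
    simp only [this]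
    rw [← Finset.sum_div, Finset.sum_sub_distrib, ← Finset.sum_mul, hb, one_mul]
  have hx := h (fun k => (u - g k) / s) fun z hz => by
    have := hfC z hz
    rw [show z = (z.1, z.2) from rfl, hf] at this
    rw [hpair _ (hsum z hz), le_div_iff₀ hs]
    linarith
  rw [hpair _ hsum1, le_div_iff₀ hs] at hx
  have := hβt t le_rfl
  rw [hf] at this
  linarith

/-- The variational inequality for a nearest point of a convex set. -/
theorem sum_mul_sub_nonpos_of_nearest {ι : Type*} [Fintype ι] {S : Set (ι → ℝ)}
    (hS : Convex ℝ S) {y p : ι → ℝ} (hp : p ∈ S)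
    (hmin : ∀ z ∈ S, ∑ k, (y k - p k) ^ 2 ≤ ∑ k, (y k - z k) ^ 2) {z : ι → ℝ} (hz : z ∈ S) :
    ∑ k, (y k - p k) * (z k - p k) ≤ 0 := by
  set c := ∑ k, (y k - p k) * (z k - p k) with hc
  set d := ∑ k, (z k - p k) ^ 2 with hd
  have hd0 : 0 ≤ d := Finset.sum_nonneg fun k _ => sq_nonneg _
  have key : ∀ ε : ℝ, 0 ≤ ε → ε ≤ 1 → 2 * ε * c ≤ ε ^ 2 * d := by
    intro ε h0 h1
    have h := hmin _ (hS hp hz (sub_nonneg.2 h1) h0 (by ring))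
    have e : ∑ k, (y k - ((1 - ε) • p + ε • z) k) ^ 2 =
        ∑ k, (y k - p k) ^ 2 - 2 * ε * c + ε ^ 2 * d := by
      rw [hc, hd, Finset.mul_sum, Finset.mul_sum, ← Finset.sum_sub_distrib,
        ← Finset.sum_add_distrib]
      refine Finset.sum_congr rfl fun k _ => ?_
      simp only [Pi.add_apply, Pi.smul_apply, smul_eq_mul]
      ring
    linarith
  by_contra! hpos
  have hε : 0 < c / (c + d) := by positivity
  have h := key (c / (c + d)) hε.le (by rw [div_le_one (by positivity)]; linarith)
  have h2 : 2 * c ≤ c / (c + d) * d := le_of_mul_le_mul_left (by linarith) hε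
  have h3 : c / (c + d) * d ≤ c := by
    rw [div_mul_eq_mul_div, div_le_iff₀ (by positivity)]
    nlinarith
  linarith

end Convexity

section Envelope

variable {X : Type*} [Fintype X] {K m : ℕ} {ν : Fin m → Fin K → X → ℝ} {R : ℝ}
  {M : Finset (Fin m × Fin m)} {βt : Fin m × Fin m → Fin m → ℝ}

/-- An upper bound of `I` and of the perturbed values, linear in `β`, bounds the envelope. -/
theorem Iconc_le_of_dominating {x : Fin m → ℝ} (hM : ∀ p ∈ M, R ≤ ∑ k, βt p k * x k)
    (hI : ∀ β ∈ stdSimplex ℝ (Fin m), Ifun ν β ≤ ∑ k, β k * x k) {β : Fin m → ℝ}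
    (hβ : β ∈ stdSimplex ℝ (Fin m)) : Iconc ν R M βt β ≤ ∑ k, β k * x k := by
  refine csSup_le ⟨Ifun ν β, 0, 1, β, by simp, by simp, by simp, hβ, by simp, by simp⟩ ?_
  rintro r ⟨lam, lb, β', hlam, hlb, -, hβ', rfl, rfl⟩
  have e : ∑ k, (∑ p : {p // p ∈ M}, lam p * βt p.1 k + lb * β' k) * x k =
      ∑ p : {p // p ∈ M}, lam p * (∑ k, βt p.1 k * x k) + lb * ∑ k, β' k * x k := by
    simp only [add_mul, Finset.sum_add_distrib, Finset.mul_sum, Finset.sum_mul, mul_assoc]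
    rw [Finset.sum_comm]
  rw [e, Finset.mul_sum]
  refine add_le_add (Finset.sum_le_sum fun p _ => ?_) (mul_le_mul_of_nonneg_left (hI _ hβ') hlb)
  rw [mul_comm]
  exact mul_le_mul_of_nonneg_left (hM p.1 p.2) (hlam p)

/-- The points `(Σ λ_p β̃_p, R)` with `λ` in the simplex over `M`. -/
def perturbedFace (R : ℝ) (M : Finset (Fin m × Fin m)) (βt : Fin m × Fin m → Fin m → ℝ) :
    Set ((Fin m → ℝ) × ℝ) :=
  ((Fintype.linearCombination ℝ fun p : {p // p ∈ M} => βt p.1) ''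
    stdSimplex ℝ {p // p ∈ M}) ×ˢ {R}

/-- The part of the hypograph of `I` over the simplex lying above level zero. -/
def truncatedHypograph (ν : Fin m → Fin K → X → ℝ) : Set ((Fin m → ℝ) × ℝ) :=
  {z | z.1 ∈ stdSimplex ℝ (Fin m) ∧ 0 ≤ z.2 ∧ z.2 ≤ Ifun ν z.1}

theorem convex_perturbedFace : Convex ℝ (perturbedFace R M βt) :=
  ((convex_stdSimplex ℝ _).linear_image _).prod (convex_singleton R)

theorem isCompact_perturbedFace : IsCompact (perturbedFace R M βt) :=
  ((isCompact_stdSimplex ℝ _).image (LinearMap.continuous_on_pi _)).prod isCompact_singleton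

theorem linearCombination_mem_stdSimplex (hβt : ∀ p ∈ M, βt p ∈ stdSimplex ℝ (Fin m))
    {lam : {p // p ∈ M} → ℝ} (hlam : lam ∈ stdSimplex ℝ {p // p ∈ M}) :
    Fintype.linearCombination ℝ (fun p : {p // p ∈ M} => βt p.1) lam ∈ stdSimplex ℝ (Fin m) := by
  rw [Fintype.linearCombination_apply]
  exact (convex_stdSimplex ℝ _).sum_mem (fun p _ => hlam.1 p) hlam.2 fun p _ => hβt p.1 p.2

theorem convex_truncatedHypograph [Nonempty X] [Nonempty (Fin K)]
    (hfull : ∀ i a x, 0 < ν i a x) : Convex ℝ (truncatedHypograph ν) := by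
  have h : truncatedHypograph ν =
      {z | z.1 ∈ stdSimplex ℝ (Fin m) ∧ z.2 ≤ Ifun ν z.1} ∩ Prod.snd ⁻¹' Set.Ici (0 : ℝ) := by
    ext z
    simp only [truncatedHypograph, Set.mem_ofPred_eq, Set.mem_inter_iff, Set.mem_preimage,
      Set.mem_Ici]
    tauto
  rw [h]
  exact (concaveOn_Ifun hfull).convex_hypograph.inter
    ((convex_Ici 0).linear_preimage (LinearMap.snd ℝ (Fin m → ℝ) ℝ))

theorem exists_forall_Ifun_le [Nonempty X] [Nonempty (Fin K)] (hfull : ∀ i a x, 0 < ν i a x) :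
    ∃ B, ∀ β ∈ stdSimplex ℝ (Fin m), Ifun ν β ≤ B := by
  obtain ⟨B, hB⟩ := (isCompact_stdSimplex ℝ (Fin m)).bddAbove_image
    (continuous_Ifun hfull).continuousOn
  exact ⟨B, fun β hβ => hB (Set.mem_image_of_mem _ hβ)⟩

theorem isCompact_truncatedHypograph [Nonempty X] [Nonempty (Fin K)]
    (hfull : ∀ i a x, 0 < ν i a x) : IsCompact (truncatedHypograph ν) := by
  obtain ⟨B, hB⟩ := exists_forall_Ifun_le (m := m) hfull
  refine ((isCompact_stdSimplex ℝ (Fin m)).prod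
    (isCompact_Icc (a := (0 : ℝ)) (b := B))).of_isClosed_subset ?_
      fun z hz => ⟨hz.1, hz.2.1, hz.2.2.trans (hB _ hz.1)⟩
  exact ((isClosed_stdSimplex ℝ (Fin m)).preimage continuous_fst).inter
    ((isClosed_le continuous_const continuous_snd).inter
      (isClosed_le continuous_snd ((continuous_Ifun hfull).comp continuous_fst)))

theorem mem_perturbedFace {p : Fin m × Fin m} (hp : p ∈ M) :
    (βt p, R) ∈ perturbedFace R M βt := by
  classical
  exact ⟨⟨Pi.single ⟨p, hp⟩ 1, single_mem_stdSimplex ℝ _, by simp⟩, rfl⟩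

theorem fst_mem_stdSimplex_of_mem_convexJoin (hβt : ∀ p ∈ M, βt p ∈ stdSimplex ℝ (Fin m))
    {z : (Fin m → ℝ) × ℝ}
    (hz : z ∈ convexJoin ℝ (perturbedFace R M βt) (truncatedHypograph ν)) :
    z.1 ∈ stdSimplex ℝ (Fin m) := by
  have h : convexJoin ℝ (perturbedFace R M βt) (truncatedHypograph ν) ⊆
      LinearMap.fst ℝ (Fin m → ℝ) ℝ ⁻¹' stdSimplex ℝ (Fin m) := by
    refine convexJoin_subset ?_ (fun z hz => hz.1) ((convex_stdSimplex ℝ (Fin m)).linear_preimage _)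
    rintro z ⟨⟨lam, hlam, hz⟩, -⟩
    rw [Set.mem_preimage, LinearMap.fst_apply, ← hz]
    exact linearCombination_mem_stdSimplex hβt hlam
  exact h hz

/-- Points of the convex join of the perturbed face and the hypograph lie below `L`. -/
theorem exists_le_Jfun_of_mem_convexJoin [Nonempty X] [Nonempty (Fin K)]
    (hfull : ∀ i a x, 0 < ν i a x)
    (hβt : ∀ p ∈ M, βt p ∈ stdSimplex ℝ (Fin m))
    (hR : ∀ lam ∈ stdSimplex ℝ {p // p ∈ M},
      R ≤ Lfun ν (Fintype.linearCombination ℝ (fun p : {p // p ∈ M} => βt p.1) lam))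
    {β : Fin m → ℝ} {r : ℝ}
    (h : (β, r) ∈ convexJoin ℝ (perturbedFace R M βt) (truncatedHypograph ν)) :
    ∃ a, r ≤ Jfun ν a β := by
  obtain ⟨⟨b, R'⟩, ⟨⟨lam, hlam, rfl⟩, hR'⟩, ⟨β', r'⟩, ⟨hβ', -, hr'⟩, c, d, hc, hd, hcd, hz⟩ :=
    mem_convexJoin.1 h
  obtain rfl : R' = R := hR'
  obtain ⟨h1, h2⟩ := Prod.ext_iff.1 hz
  obtain ⟨a, ha⟩ := exists_eq_ciSup_of_finite
    (f := fun a => Jfun ν a (Fintype.linearCombination ℝ (fun p : {p // p ∈ M} => βt p.1) lam))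
  refine ⟨a, ?_⟩
  have hconc := (concaveOn_Jfun hfull a).2 (linearCombination_mem_stdSimplex hβt hlam) hβ' hc hd hcd
  have hRa : R' ≤ Jfun ν a (Fintype.linearCombination ℝ (fun p : {p // p ∈ M} => βt p.1) lam) :=
    (hR lam hlam).trans_eq ha.symm
  have hra : r' ≤ Jfun ν a β' := hr'.trans (Ifun_le_Jfun a β')
  simp only [Prod.fst_add, Prod.smul_fst, Prod.snd_add, Prod.smul_snd, smul_eq_mul] at h1 h2
  rw [h1] at hconc
  rw [← h2]
  refine le_trans ?_ hconc
  simp only [smul_eq_mul]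
  gcongr

/-- The support function of the set of vectors dominating the envelope lies below `L`. -/
theorem exists_le_Jfun_of_forall_dominating [Nonempty X] [Nonempty (Fin K)]
    (hν : ∀ i a, IsPMF (ν i a)) (hfull : ∀ i a x, 0 < ν i a x) (hM : M.Nonempty)
    (hβt : ∀ p ∈ M, βt p ∈ stdSimplex ℝ (Fin m))
    (hR : ∀ lam ∈ stdSimplex ℝ {p // p ∈ M},
      R ≤ Lfun ν (Fintype.linearCombination ℝ (fun p : {p // p ∈ M} => βt p.1) lam))
    {β : Fin m → ℝ} (hβ : β ∈ stdSimplex ℝ (Fin m)) {t : ℝ}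
    (h : ∀ x : Fin m → ℝ, (∀ γ ∈ stdSimplex ℝ (Fin m), Iconc ν R M βt γ ≤ ∑ k, γ k * x k) →
      t ≤ ∑ k, β k * x k) :
    ∃ a, t ≤ Jfun ν a β := by
  have hgraph : ∀ γ ∈ stdSimplex ℝ (Fin m), (γ, Ifun ν γ) ∈ truncatedHypograph ν := fun γ hγ =>
    ⟨hγ, Ifun_nonneg hν hfull hγ, le_rfl⟩
  have hface : (perturbedFace R M βt).Nonempty := by
    obtain ⟨p, hp⟩ := hM
    exact ⟨_, mem_perturbedFace hp⟩
  have hleft : perturbedFace R M βt ⊆ convexJoin ℝ (perturbedFace R M βt) (truncatedHypograph ν) :=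
    subset_convexJoin_left ⟨_, hgraph β hβ⟩
  have hright : truncatedHypograph ν ⊆
      convexJoin ℝ (perturbedFace R M βt) (truncatedHypograph ν) :=
    subset_convexJoin_right hface
  have hdom : ∀ x : Fin m → ℝ,
      (∀ z ∈ convexJoin ℝ (perturbedFace R M βt) (truncatedHypograph ν),
        z.2 ≤ ∑ k, z.1 k * x k) → t ≤ ∑ k, β k * x k := by
    intro x hx
    refine h x fun γ hγ => Iconc_le_of_dominating (fun p hp => ?_) (fun γ hγ => ?_) hγ
    · exact hx (βt p, R) (hleft (mem_perturbedFace hp))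
    · exact hx (γ, Ifun ν γ) (hright (hgraph γ hγ))
  have hcompact := isCompact_convexJoin (isCompact_perturbedFace (R := R) (M := M) (βt := βt))
    (isCompact_truncatedHypograph hfull)
  have hconvex := (convex_perturbedFace (R := R) (M := M) (βt := βt)).convexJoin
    (convex_truncatedHypograph hfull)
  obtain ⟨r, htr, hr⟩ := exists_mem_ge_of_forall_dominating hcompact hconvex
    (fun z hz => (fst_mem_stdSimplex_of_mem_convexJoin hβt hz).2)
    ⟨_, hright (hgraph β hβ)⟩ hdom
  obtain ⟨a, ha⟩ := exists_le_Jfun_of_mem_convexJoin hfull hβt hR hr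
  exact ⟨a, htr.trans ha⟩

end Envelope

/-- **Theorem 10 of the paper (`Ŝ` is a Blackwell B-set).**
Under `R ≤ inf_{λ ∈ Δ_M} L(Σ λ_{ij} β̃_{ij})`, the set
`Ŝ = {x | ∀ β ∈ Δ_m, ⟨β, x⟩ ≥ I'_concave(β)}` is closed, convex and nonempty, and for
every `y ∉ Ŝ` with Euclidean nearest point `y*` in `Ŝ` there is `w ∈ Δ_K` such that
`⟨y − y*, f(w,Q) − y*⟩ ≤ 0` for every `Q`, where `f_i(w,Q) = Σ_a w(a) D(Q_a‖ν^i_a)`. -/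
theorem stmt_16 {X : Type*} [Fintype X] [Nonempty X] (K m : ℕ) (hK : 1 ≤ K) (hm : 2 ≤ m)
    (ν : Fin m → Fin K → X → ℝ) (hν : ∀ i a, IsPMF (ν i a))
    (hfull : ∀ i a x, 0 < ν i a x)
    (M : Finset (Fin m × Fin m)) (hMne : M.Nonempty) (hMlt : ∀ p ∈ M, p.1 < p.2)
    (βt : Fin m × Fin m → Fin m → ℝ)
    (hβt : ∀ p ∈ M, βt p ∈ stdSimplex ℝ (Fin m) ∧
      ∀ k, k ≠ p.1 → k ≠ p.2 → βt p k = 0)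
    (R : ℝ)
    (hR : R ≤ ⨅ lam : {l : {p // p ∈ M} → ℝ // (∀ p, 0 ≤ l p) ∧ ∑ p, l p = 1},
      Lfun ν (fun k => ∑ p : {p // p ∈ M}, lam.1 p * βt p.1 k))
    (S : Set (Fin m → ℝ))
    (hS : S = {x | ∀ β ∈ stdSimplex ℝ (Fin m), Iconc ν R M βt β ≤ ∑ k, β k * x k}) :
    IsClosed S ∧ Convex ℝ S ∧ S.Nonempty ∧
    ∀ y ∉ S, ∀ ystar ∈ S,
      (∀ z ∈ S, Real.sqrt (∑ k, (y k - ystar k) ^ 2) ≤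
        Real.sqrt (∑ k, (y k - z k) ^ 2)) →
      ∃ w : Fin K → ℝ, IsPMF w ∧
        ∀ Q : Fin K → {q : X → ℝ // IsPMF q},
          ∑ k, (y k - ystar k) * ((∑ a, w a * KL (Q a).1 (ν k a)) - ystar k) ≤ 0 := by
  classical
  have : Nonempty (Fin K) := ⟨⟨0, hK⟩⟩
  have hβt' : ∀ p ∈ M, βt p ∈ stdSimplex ℝ (Fin m) := fun p hp => (hβt p hp).1
  have hR' : ∀ lam ∈ stdSimplex ℝ {p // p ∈ M},
      R ≤ Lfun ν (Fintype.linearCombination ℝ (fun p : {p // p ∈ M} => βt p.1) lam) := by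
    have e : ∀ lam : {p // p ∈ M} → ℝ, (fun k => ∑ p : {p // p ∈ M}, lam p * βt p.1 k) =
        Fintype.linearCombination ℝ (fun p : {p // p ∈ M} => βt p.1) lam := fun lam => by
      ext k
      simp [Fintype.linearCombination_apply, Finset.sum_apply]
    intro lam hlam
    rw [← e]
    refine hR.trans (ciInf_le (f := fun lam : {l : {p // p ∈ M} → ℝ //
      (∀ p, 0 ≤ l p) ∧ ∑ p, l p = 1} => Lfun ν (fun k => ∑ p : {p // p ∈ M}, lam.1 p * βt p.1 k))
      ⟨0, ?_⟩ ⟨lam, hlam⟩)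
    rintro _ ⟨l, rfl⟩
    refine Real.iSup_nonneg fun a => ?_
    rw [e]
    exact Jfun_nonneg hν hfull a (linearCombination_mem_stdSimplex hβt' l.2)
  have hclosed : IsClosed S := by
    have : S = ⋂ β ∈ stdSimplex ℝ (Fin m),
        {x : Fin m → ℝ | Iconc ν R M βt β ≤ ∑ k, β k * x k} := by
      rw [hS]
      ext x
      simp
    rw [this]
    exact isClosed_biInter fun β _ => isClosed_le continuous_const (by fun_prop)
  have hconv : Convex ℝ S := by
    rw [hS]
    intro x hx z hz s t hs ht hst β hβ
    have e : ∑ k, β k * (s • x + t • z) k = s * ∑ k, β k * x k + t * ∑ k, β k * z k := by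
      simp only [Finset.mul_sum, ← Finset.sum_add_distrib, Pi.add_apply, Pi.smul_apply, smul_eq_mul]
      exact Finset.sum_congr rfl fun k _ => by ring
    rw [e]
    calc Iconc ν R M βt β = s * Iconc ν R M βt β + t * Iconc ν R M βt β := by
          rw [← add_mul, hst, one_mul]
      _ ≤ _ := add_le_add (mul_le_mul_of_nonneg_left (hx β hβ) hs)
          (mul_le_mul_of_nonneg_left (hz β hβ) ht)
  refine ⟨hclosed, hconv, ?_, ?_⟩
  · obtain ⟨B, hB⟩ := exists_forall_Ifun_le (m := m) hfull
    refine ⟨fun _ => max R B, ?_⟩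
    rw [hS]
    refine fun β hβ => Iconc_le_of_dominating (fun p hp => ?_) (fun γ hγ => ?_) hβ
    · rw [← Finset.sum_mul, (hβt' p hp).2, one_mul]
      exact le_max_left R B
    · rw [← Finset.sum_mul, hγ.2, one_mul]
      exact (hB γ hγ).trans (le_max_right R B)
  intro y hy p hp hnear
  have hvar : ∀ z ∈ S, ∑ k, (y k - p k) * (z k - p k) ≤ 0 := fun z hz =>
    sum_mul_sub_nonpos_of_nearest hconv hp (fun z hz => (Real.sqrt_le_sqrt_iff
      (Finset.sum_nonneg fun k _ => sq_nonneg _)).1 (hnear z hz)) hz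
  have hnonneg : ∀ k, 0 ≤ p k - y k := by
    intro k
    have hmem : p + Pi.single k 1 ∈ S := by
      rw [hS] at hp ⊢
      refine fun β hβ => (hp β hβ).trans (Finset.sum_le_sum fun j _ => ?_)
      refine mul_le_mul_of_nonneg_left ?_ (hβ.1 j)
      rw [Pi.add_apply, Pi.single_apply]
      split_ifs <;> simp
    have h := hvar _ hmem
    simp [Pi.single_apply] at h
    linarith
  set U := ∑ k, (p k - y k)
  have hUpos : 0 < U := by
    refine (Finset.sum_nonneg fun k _ => hnonneg k).lt_of_ne' fun h0 => hy ?_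
    have h := (Finset.sum_eq_zero_iff_of_nonneg fun k _ => hnonneg k).1 h0
    have : y = p := funext fun k => by linarith [h k (Finset.mem_univ k)]
    rwa [this]
  have hpair : ∀ x : Fin m → ℝ, ∑ k, (p k - y k) / U * x k = (∑ k, (p k - y k) * x k) / U := by
    intro x
    rw [Finset.sum_div]
    exact Finset.sum_congr rfl fun k _ => by ring
  have hβ : (fun k => (p k - y k) / U) ∈ stdSimplex ℝ (Fin m) :=
    ⟨fun k => div_nonneg (hnonneg k) hUpos.le, by rw [← Finset.sum_div, div_self hUpos.ne']⟩
  have hsplit : ∀ x : Fin m → ℝ, ∑ k, (y k - p k) * (x k - p k) =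
      ∑ k, (p k - y k) * p k - ∑ k, (p k - y k) * x k := by
    intro x
    rw [← Finset.sum_sub_distrib]
    exact Finset.sum_congr rfl fun k _ => by ring
  obtain ⟨a, ha⟩ := exists_le_Jfun_of_forall_dominating hν hfull hMne hβt' hR' hβ
    (t := ∑ k, (p k - y k) / U * p k) fun x hx => by
      have h := hvar x (by rw [hS]; exact hx)
      rw [hsplit] at h
      rw [hpair, hpair]
      exact div_le_div_of_nonneg_right (by linarith) hUpos.le
  refine ⟨Pi.single a 1, ⟨fun b => ?_, by simp⟩, fun Q => ?_⟩
  · rw [Pi.single_apply]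
    split_ifs <;> simp
  · have h := ha.trans (Jfun_le_sum_mul_KL hfull a hβ.2 (Q a).2)
    rw [hpair, hpair, div_le_div_iff_of_pos_right hUpos] at h
    simp only [Pi.single_apply, ite_mul, one_mul, zero_mul, Finset.sum_ite_eq',
      Finset.mem_univ, if_true]
    rw [hsplit]
    linarith
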